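/- Two consecutive X-basis measurements on a linear three-qubit graph state with input teleport the input qubit up to a Pauli byproduct: for every ψ ∈ ℂ² and every s₁, s₂ ∈ {0,1}, ((⟨0|+(−1)^{s₁}⟨1|)/√2 ⊗ (⟨0|+(−1)^{s₂}⟨1|)/√2 ⊗ I₂)·(I₂⊗CZ)·(CZ⊗I₂)·(ψ ⊗ |+⟩ ⊗ |+⟩) = (1/2)·X^{s₂}·Z^{s₁}·ψ. (This is the measurement pattern realizing the identity operator on a path of even length, with the byproduct being a tensor product of X and Z.) -/

import Mathlib

/-!
STATEMENT 6: Two consecutive X-basis measurements on a linear three-qubit graph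
state with input teleport the input qubit up to a Pauli byproduct:
((⟨0|+(−1)^{s₁}⟨1|)/√2 ⊗ (⟨0|+(−1)^{s₂}⟨1|)/√2 ⊗ I₂)·(I₂⊗CZ)·(CZ⊗I₂)·(ψ⊗|+⟩⊗|+⟩)
  = (1/2)·X^{s₂}·Z^{s₁}·ψ.
Three-qubit objects are indexed by Fin 2 × Fin 2 × Fin 2 (right-associated).
-/

open Matrix Kronecker

noncomputable section

/-- Pauli X. -/
def PX : Matrix (Fin 2) (Fin 2) ℂ := !![0, 1; 1, 0]

/-- Pauli Z. -/
def PZ : Matrix (Fin 2) (Fin 2) ℂ := !![1, 0; 0, -1]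

/-- 2×2 identity. -/
def I2 : Matrix (Fin 2) (Fin 2) ℂ := 1

/-- Controlled-Z gate CZ = |0⟩⟨0| ⊗ I₂ + |1⟩⟨1| ⊗ Z = diag(1,1,1,−1). -/
def CZ : Matrix (Fin 2 × Fin 2) (Fin 2 × Fin 2) ℂ :=
  !![1, 0; 0, 0] ⊗ₖ I2 + !![0, 0; 0, 1] ⊗ₖ PZ

/-- CZ ⊗ I₂ on qubits 1 and 2, reindexed to the right-associated index. -/
def CZ12 : Matrix (Fin 2 × Fin 2 × Fin 2) (Fin 2 × Fin 2 × Fin 2) ℂ :=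
  Matrix.reindex (Equiv.prodAssoc (Fin 2) (Fin 2) (Fin 2))
    (Equiv.prodAssoc (Fin 2) (Fin 2) (Fin 2)) (CZ ⊗ₖ I2)

/-- I₂ ⊗ CZ on qubits 2 and 3. -/
def CZ23 : Matrix (Fin 2 × Fin 2 × Fin 2) (Fin 2 × Fin 2 × Fin 2) ℂ := I2 ⊗ₖ CZ

/-- The state |+⟩ = (|0⟩ + |1⟩)/√2. -/
def ketPlus : Fin 2 → ℂ := fun i => (![1, 0] i + ![0, 1] i) / (Real.sqrt 2 : ℂ)

/-- The X-basis bra (⟨0| + (−1)^s ⟨1|)/√2. -/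
def braX (s : ℕ) : Fin 2 → ℂ :=
  fun i => (![1, 0] i + (-1 : ℂ) ^ s * ![0, 1] i) / (Real.sqrt 2 : ℂ)

/-- The controlled-Z gate is diagonal with entries `(-1)^(ab)`. -/
lemma CZ_eq_diagonal :
    CZ = Matrix.diagonal fun p : Fin 2 × Fin 2 => (-1 : ℂ) ^ (p.1.val * p.2.val) := by
  ext ⟨a, b⟩ ⟨c, d⟩
  fin_cases a <;> fin_cases b <;> fin_cases c <;> fin_cases d <;>
    simp [CZ, I2, PZ]

lemma CZ23_eq_diagonal :
    CZ23 = Matrix.diagonal fun p : Fin 2 × Fin 2 × Fin 2 =>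
      (-1 : ℂ) ^ (p.2.1.val * p.2.2.val) := by
  rw [CZ23, CZ_eq_diagonal, I2, ← Matrix.diagonal_one, Matrix.diagonal_kronecker_diagonal]
  simp

lemma CZ12_eq_diagonal :
    CZ12 = Matrix.diagonal fun p : Fin 2 × Fin 2 × Fin 2 =>
      (-1 : ℂ) ^ (p.1.val * p.2.1.val) := by
  rw [CZ12, CZ_eq_diagonal, I2, ← Matrix.diagonal_one, Matrix.diagonal_kronecker_diagonal,
    Matrix.reindex_apply, Matrix.submatrix_diagonal_equiv]
  congr 1
  ext ⟨a, b, c⟩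
  simp

/-- The measurement pattern realizing the identity operator on a path of even
length: X-basis measurements with outcomes s₁, s₂ on the first two qubits of
(I₂⊗CZ)(CZ⊗I₂)(ψ⊗|+⟩⊗|+⟩) leave the third qubit in the state (1/2)·X^{s₂}·Z^{s₁}·ψ.
The row operator (braX s₁ ⊗ braX s₂ ⊗ I₂) is written as a 2×8 matrix (the trivial
one-dimensional row indices of the bras are collapsed). -/
theorem two_xBasis_measurements_teleport (ψ : Fin 2 → ℂ) (s₁ s₂ : ℕ)
    (hs₁ : s₁ = 0 ∨ s₁ = 1) (hs₂ : s₂ = 0 ∨ s₂ = 1) :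
    ((Matrix.of fun (j : Fin 2) (p : Fin 2 × Fin 2 × Fin 2) =>
        braX s₁ p.1 * braX s₂ p.2.1 * (if j = p.2.2 then (1 : ℂ) else 0))
      * CZ23 * CZ12).mulVec
      (fun p : Fin 2 × Fin 2 × Fin 2 => ψ p.1 * ketPlus p.2.1 * ketPlus p.2.2)
    = ((1 : ℂ) / 2) • (PX ^ s₂ * PZ ^ s₁).mulVec ψ := by
  have h_sqrt : ((Real.sqrt 2 : ℝ) : ℂ) ^ 2 = 2 := by
    rw [← Complex.ofReal_pow, Real.sq_sqrt zero_le_two, Complex.ofReal_ofNat]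
  have h_ne : ((Real.sqrt 2 : ℝ) : ℂ) ≠ 0 := by
    intro h
    simp [h] at h_sqrt
  have h_four : ((Real.sqrt 2 : ℝ) : ℂ) ^ 4 = 4 := by
    linear_combination (((Real.sqrt 2 : ℝ) : ℂ) ^ 2 + 2) * h_sqrt
  rw [CZ23_eq_diagonal, CZ12_eq_diagonal]
  ext j
  rcases hs₁ with rfl | rfl <;> rcases hs₂ with rfl | rfl <;> fin_cases j <;>
    simp [Matrix.mulVec, dotProduct, Fintype.sum_prod_type, Matrix.mul_diagonal, braX,
      ketPlus, PX, PZ] <;>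
    field_simp <;> rw [h_four] <;> ring

end
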